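/- Let d ≤ m, let Ξ be an integer d×m matrix whose first d columns are linearly independent, and let r(Ξ) be the minimal number of columns that can be removed from Ξ so that the remaining columns do not span ℝ^d. Then the box spline space has approximation order r(Ξ) in the uniform norm: for every compactly supported C^∞ function f : ℝ^d → ℝ there exists a constant C > 0 such that for every h with 0 < h < 1 there exist coefficients c_h : ℤ^d → ℝ with sup_{x ∈ ℝ^d} | f(x) − ∑_{j ∈ ℤ^d} c_h(j) M_Ξ(x/h − j) | ≤ C · h^{r(Ξ)}. -/

import Mathlib

open MeasureTheory

/-- The centered box spline for a `d × (d+n)` direction matrix, by recursion on `n`: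
for `n = 0` it is the normalized indicator of the half-open parallelepiped
`Ξ [-1/2,1/2)^d`; for `n+1` it is the average of the translates of the box spline of
`Ξ` with its last column removed, in the direction of that last column. -/
noncomputable def boxSplineAux (d : ℕ) : (n : ℕ) → Matrix (Fin d) (Fin (d + n)) ℝ → ((Fin d → ℝ) → ℝ)
  | 0, Ξ => fun x =>
      Set.indicator
        {y : Fin d → ℝ | ∃ t : Fin d → ℝ, (∀ i, t i ∈ Set.Ico (-(1:ℝ)/2) (1/2)) ∧
          y = Matrix.mulVec (Matrix.of fun (i j : Fin d) => Ξ i (Fin.cast (Nat.add_zero d).symm j)) t}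
        (fun _ => |Matrix.det (Matrix.of fun (i j : Fin d) => Ξ i (Fin.cast (Nat.add_zero d).symm j))|⁻¹) x
  | (n+1), Ξ => fun x =>
      ∫ t in (-(1:ℝ)/2)..(1/2),
        boxSplineAux d n (fun i j => Ξ i (Fin.castSucc j)) (x - t • fun i => Ξ i (Fin.last (d + n)))

/-- The centered box spline `M_Ξ` of a `d × m` direction matrix `Ξ`, `d ≤ m`. -/
noncomputable def boxSpline {d m : ℕ} (hdm : d ≤ m) (Ξ : Matrix (Fin d) (Fin m) ℝ) :
    (Fin d → ℝ) → ℝ :=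
  boxSplineAux d (m - d) (fun i j => Ξ i (Fin.cast (Nat.add_sub_cancel' hdm) j))

/-- `boxSplineR Ξ` : the minimal number of columns that can be removed from `Ξ` so that
the remaining columns do not span `ℝ^d`. -/
noncomputable def boxSplineR {d m : ℕ} (Ξ : Matrix (Fin d) (Fin m) ℝ) : ℕ :=
  sInf {k : ℕ | ∃ S : Finset (Fin m), S.card = k ∧
    Submodule.span ℝ ((fun j => fun i => Ξ i j) '' (↑Sᶜ : Set (Fin m))) ≠ ⊤}

/-- A measurable function that is bounded on bounded sets. -/
structure IsTame {d : ℕ} (g : (Fin d → ℝ) → ℝ) : Prop where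
  measurable : Measurable g
  bounded : ∀ R : ℝ, ∃ C : ℝ, ∀ x, ‖x‖ ≤ R → |g x| ≤ C

/-- The average of a function over the segments `x + [-1/2, 1/2] • ξ`. -/
noncomputable def segmentAverage {d : ℕ} (ξ : Fin d → ℝ) (g : (Fin d → ℝ) → ℝ) :
    (Fin d → ℝ) → ℝ :=
  fun x => ∫ t in (-(1 : ℝ) / 2)..(1 / 2), g (x - t • ξ)

/-- Polynomial functions of degree less than `k`, described by vanishing iterated differences. -/
def IsPolyLT {d : ℕ} : ℕ → ((Fin d → ℝ) → ℝ) → Prop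
  | 0, p => ∀ x, p x = 0
  | k + 1, p => IsTame p ∧ ∀ v, IsPolyLT k fun x => p (x + v) - p x

namespace IsTame

variable {d : ℕ} {g g₁ g₂ : (Fin d → ℝ) → ℝ}

theorem of_continuous (hg : Continuous g) : IsTame g where
  measurable := hg.measurable
  bounded R := by
    obtain ⟨C, hC⟩ := (isCompact_closedBall (0 : Fin d → ℝ) R).exists_bound_of_continuousOn
      hg.continuousOn
    exact ⟨C, fun x hx => hC x (by simpa using hx)⟩

theorem add (h₁ : IsTame g₁) (h₂ : IsTame g₂) : IsTame fun x => g₁ x + g₂ x where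
  measurable := h₁.measurable.add h₂.measurable
  bounded R := by
    obtain ⟨C₁, hC₁⟩ := h₁.bounded R
    obtain ⟨C₂, hC₂⟩ := h₂.bounded R
    exact ⟨C₁ + C₂, fun x hx => (abs_add_le _ _).trans (add_le_add (hC₁ x hx) (hC₂ x hx))⟩

theorem mul (h₁ : IsTame g₁) (h₂ : IsTame g₂) : IsTame fun x => g₁ x * g₂ x where
  measurable := h₁.measurable.mul h₂.measurable
  bounded R := by
    obtain ⟨C₁, hC₁⟩ := h₁.bounded R
    obtain ⟨C₂, hC₂⟩ := h₂.bounded R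
    refine ⟨C₁ * C₂, fun x hx => ?_⟩
    rw [abs_mul]
    exact mul_le_mul (hC₁ x hx) (hC₂ x hx) (abs_nonneg _) ((abs_nonneg _).trans (hC₁ x hx))

theorem const (c : ℝ) : IsTame fun _ : Fin d → ℝ => c := of_continuous continuous_const

theorem const_mul (c : ℝ) (h : IsTame g) : IsTame fun x => c * g x := (const c).mul h

theorem sub (h₁ : IsTame g₁) (h₂ : IsTame g₂) : IsTame fun x => g₁ x - g₂ x := by
  simpa [sub_eq_add_neg] using h₁.add (h₂.const_mul (-1))

theorem comp_smul_add (h : IsTame g) (c : ℝ) (v : Fin d → ℝ) :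
    IsTame fun x => g (c • x + v) where
  measurable := h.measurable.comp (by fun_prop)
  bounded R := by
    obtain ⟨C, hC⟩ := h.bounded (|c| * R + ‖v‖)
    refine ⟨C, fun x hx => hC _ ((norm_add_le _ _).trans ?_)⟩
    rw [norm_smul, Real.norm_eq_abs]
    gcongr

theorem comp_add (h : IsTame g) (v : Fin d → ℝ) : IsTame fun x => g (x + v) := by
  simpa using h.comp_smul_add 1 v

theorem intervalIntegrable (h : IsTame g) (x v : Fin d → ℝ) (a b : ℝ) :
    IntervalIntegrable (fun t : ℝ => g (x + t • v)) volume a b := by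
  obtain ⟨C, hC⟩ := h.bounded (‖x‖ + max |a| |b| * ‖v‖)
  refine (intervalIntegrable_const (c := C)).mono_fun
    (h.measurable.comp (by fun_prop)).aestronglyMeasurable ?_
  refine (ae_restrict_iff' measurableSet_uIoc).2 (.of_forall fun t ht => ?_)
  rw [Real.norm_eq_abs]
  refine (hC _ ((norm_add_le _ _).trans ?_)).trans (le_abs_self _)
  rw [norm_smul, Real.norm_eq_abs]
  gcongr
  rcases Set.mem_uIoc.1 ht with ht | ht
  · exact abs_le_max_abs_abs ht.1.le ht.2
  · rw [max_comm]; exact abs_le_max_abs_abs ht.1.le ht.2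

theorem measurable_integral (h : Measurable g) (v : Fin d → ℝ) (a b : ℝ) :
    Measurable fun x => ∫ t in a..b, g (x + t • v) := by
  have : StronglyMeasurable (Function.uncurry fun (x : Fin d → ℝ) (t : ℝ) => g (x + t • v)) :=
    (h.comp (by fun_prop)).stronglyMeasurable
  simp only [intervalIntegral]
  exact (this.integral_prod_right.sub this.integral_prod_right).measurable

theorem integral (h : IsTame g) (v : Fin d → ℝ) (a b : ℝ) :
    IsTame fun x => ∫ t in a..b, g (x + t • v) where
  measurable := measurable_integral h.measurable v a b
  bounded R := by
    obtain ⟨C, hC⟩ := h.bounded (R + max |a| |b| * ‖v‖)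
    refine ⟨C * |b - a|, fun x hx => ?_⟩
    rw [← Real.norm_eq_abs]
    refine intervalIntegral.norm_integral_le_of_norm_le_const fun t ht => hC _ ?_
    refine (norm_add_le _ _).trans ?_
    rw [norm_smul, Real.norm_eq_abs]
    gcongr
    rcases Set.mem_uIoc.1 ht with ht | ht
    · exact abs_le_max_abs_abs ht.1.le ht.2
    · rw [max_comm]; exact abs_le_max_abs_abs ht.1.le ht.2

end IsTame

section segmentAverage

variable {d : ℕ} {g g₁ g₂ : (Fin d → ℝ) → ℝ}

theorem segmentAverage_eq (ξ : Fin d → ℝ) (g : (Fin d → ℝ) → ℝ) (x : Fin d → ℝ) :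
    segmentAverage ξ g x = ∫ t in (-(1 : ℝ) / 2)..(1 / 2), g (x + t • ξ) := by
  have := intervalIntegral.integral_comp_neg (a := -(1 : ℝ) / 2) (b := 1 / 2)
    fun t : ℝ => g (x + t • ξ)
  rw [show -(1 / 2 : ℝ) = -1 / 2 by norm_num, show -(-1 / 2 : ℝ) = 1 / 2 by norm_num] at this
  simpa [segmentAverage, sub_eq_add_neg] using this

theorem IsTame.segmentAverage (h : IsTame g) (ξ : Fin d → ℝ) : IsTame (segmentAverage ξ g) := by
  simpa only [← segmentAverage_eq] using h.integral ξ (-(1 : ℝ) / 2) (1 / 2)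

theorem segmentAverage_sub (h₁ : IsTame g₁) (h₂ : IsTame g₂) (ξ x : Fin d → ℝ) :
    segmentAverage ξ (fun y => g₁ y - g₂ y) x = segmentAverage ξ g₁ x - segmentAverage ξ g₂ x := by
  simp only [segmentAverage_eq]
  exact intervalIntegral.integral_sub (h₁.intervalIntegrable _ _ _ _)
    (h₂.intervalIntegrable _ _ _ _)

theorem segmentAverage_comp_add (ξ v x : Fin d → ℝ) :
    segmentAverage ξ (fun y => g (y + v)) x = segmentAverage ξ g (x + v) := by
  simp [segmentAverage_eq, add_right_comm]

/-- Fundamental theorem of calculus for segment averages, in the direction of the segment. -/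
theorem segmentAverage_add_smul_sub (h : IsTame g) (ξ x : Fin d → ℝ) (s : ℝ) :
    segmentAverage ξ g (x + s • ξ) - segmentAverage ξ g x =
      ∫ u in (-(1 : ℝ) / 2)..(s - 1 / 2), (g (x + u • ξ + ξ) - g (x + u • ξ)) := by
  have hi := fun a b => h.intervalIntegrable x ξ a b
  have e₁ : segmentAverage ξ g (x + s • ξ) =
      ∫ u in (s - 1 / 2)..(s + 1 / 2), g (x + u • ξ) := by
    rw [segmentAverage_eq]
    have := intervalIntegral.integral_comp_add_right (a := -(1 : ℝ) / 2) (b := 1 / 2)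
      (fun u : ℝ => g (x + u • ξ)) s
    rw [show -1 / 2 + s = s - 1 / 2 by ring, show 1 / 2 + s = s + 1 / 2 by ring] at this
    rw [← this]
    congr 1 with t
    congr 1
    module
  have e₂ : ∫ u in (-(1 : ℝ) / 2)..(s - 1 / 2), g (x + u • ξ + ξ) =
      ∫ u in (1 / 2)..(s + 1 / 2), g (x + u • ξ) := by
    have := intervalIntegral.integral_comp_add_right (a := -(1 : ℝ) / 2) (b := s - 1 / 2)
      (fun u : ℝ => g (x + u • ξ)) 1
    rw [show -1 / 2 + 1 = (1 / 2 : ℝ) by ring, show s - 1 / 2 + 1 = s + 1 / 2 by ring] at this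
    rw [← this]
    congr 1 with t
    congr 1
    module
  have hs : IntervalIntegrable (fun u : ℝ => g (x + u • ξ + ξ)) volume (-1 / 2) (s - 1 / 2) := by
    simpa [add_right_comm] using h.intervalIntegrable (x + ξ) ξ (-1 / 2) (s - 1 / 2)
  rw [intervalIntegral.integral_sub hs (hi _ _), e₁, e₂, segmentAverage_eq]
  have a₁ := intervalIntegral.integral_add_adjacent_intervals (hi (-1 / 2) (s - 1 / 2))
    (hi (s - 1 / 2) (s + 1 / 2))
  have a₂ := intervalIntegral.integral_add_adjacent_intervals (hi (-1 / 2) (1 / 2))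
    (hi (1 / 2) (s + 1 / 2))
  linarith

end segmentAverage

namespace IsPolyLT

variable {d k : ℕ} {p q : (Fin d → ℝ) → ℝ}

theorem isTame : ∀ {k : ℕ}, IsPolyLT k p → IsTame p
  | 0, h => by
    rw [show p = fun _ => 0 from funext h]
    exact .const 0
  | _ + 1, h => h.1

theorem add : ∀ {k : ℕ} {p q : (Fin d → ℝ) → ℝ}, IsPolyLT k p → IsPolyLT k q →
    IsPolyLT k fun x => p x + q x
  | 0, _, _, hp, hq => fun x => by simp [hp x, hq x]
  | k + 1, p, q, hp, hq => ⟨hp.1.add hq.1, fun v => by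
      simpa only [add_sub_add_comm] using add (hp.2 v) (hq.2 v)⟩

theorem const_mul (c : ℝ) : ∀ {k : ℕ} {p : (Fin d → ℝ) → ℝ}, IsPolyLT k p →
    IsPolyLT k fun x => c * p x
  | 0, _, hp => fun x => by simp [hp x]
  | k + 1, p, hp => ⟨hp.1.const_mul c, fun v => by
      simpa only [mul_sub] using const_mul c (hp.2 v)⟩

theorem zero : ∀ k : ℕ, IsPolyLT k fun _ : Fin d → ℝ => (0 : ℝ)
  | 0 => fun _ => rfl
  | k + 1 => ⟨.const 0, fun _ => by simpa using zero k⟩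

theorem const (k : ℕ) (c : ℝ) : IsPolyLT (k + 1) fun _ : Fin d → ℝ => c :=
  ⟨.const c, fun _ => by simpa using zero k⟩

theorem sum {ι : Type*} (s : Finset ι) {p : ι → (Fin d → ℝ) → ℝ}
    (h : ∀ i ∈ s, IsPolyLT k (p i)) : IsPolyLT k fun x => ∑ i ∈ s, p i x := by
  classical
  induction s using Finset.induction_on with
  | empty => simpa using zero k
  | insert a s ha ih =>
    simp only [Finset.sum_insert ha]
    exact (h a (Finset.mem_insert_self a s)).add
      (ih fun i hi => h i (Finset.mem_insert_of_mem hi))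

theorem comp_smul_add (c : ℝ) (w : Fin d → ℝ) : ∀ {k : ℕ} {p : (Fin d → ℝ) → ℝ},
    IsPolyLT k p → IsPolyLT k fun x => p (c • x + w)
  | 0, _, hp => fun x => hp _
  | k + 1, p, hp => ⟨hp.1.comp_smul_add c w, fun v => by
      have := comp_smul_add c w (hp.2 (c • v))
      simpa only [smul_add, add_right_comm] using this⟩

theorem comp_add (h : IsPolyLT k p) (w : Fin d → ℝ) : IsPolyLT k fun x => p (x + w) := by
  simpa using h.comp_smul_add 1 w

theorem succ : ∀ {k : ℕ} {p : (Fin d → ℝ) → ℝ}, IsPolyLT k p → IsPolyLT (k + 1) p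
  | 0, p, hp => by
    rw [show p = fun _ => 0 from funext hp]
    exact zero 1
  | k + 1, p, hp => ⟨hp.1, fun v => succ (hp.2 v)⟩

theorem mono {k l : ℕ} (hkl : k ≤ l) (h : IsPolyLT k p) : IsPolyLT l p :=
  Nat.le_induction h (fun _ _ ih => ih.succ) l hkl

theorem coord_mul (i : Fin d) : ∀ {k : ℕ} {p : (Fin d → ℝ) → ℝ}, IsPolyLT k p →
    IsPolyLT (k + 1) fun x => x i * p x
  | 0, p, hp => by simpa only [hp _, mul_zero] using zero 1
  | k + 1, p, hp => by
    refine ⟨(IsTame.of_continuous (continuous_apply i)).mul hp.1, fun v => ?_⟩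
    have := (coord_mul i (hp.2 v)).add ((hp.comp_add v).const_mul (v i))
    convert this using 2 with x
    simp only [Pi.add_apply]
    ring

theorem integral (ξ : Fin d → ℝ) (a b : ℝ) : ∀ {k : ℕ} {p : (Fin d → ℝ) → ℝ},
    IsPolyLT k p → IsPolyLT k fun x => ∫ u in a..b, p (x + u • ξ)
  | 0, _, hp => fun x => by simp [hp _]
  | k + 1, p, hp => by
    refine ⟨hp.1.integral ξ a b, fun v => ?_⟩
    convert integral ξ a b (hp.2 v) using 2 with x
    simp only [add_right_comm x _ v]
    rw [← intervalIntegral.integral_sub (hp.1.intervalIntegrable _ _ _ _)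
      (hp.1.intervalIntegrable _ _ _ _)]

theorem eq_zero_apply (h : IsPolyLT 1 p) (x : Fin d → ℝ) : p x = p 0 := by
  simpa [sub_eq_zero] using h.2 x 0

theorem segmentAverage_sub_self (ξ : Fin d → ℝ) : ∀ {k : ℕ} {p : (Fin d → ℝ) → ℝ},
    IsPolyLT (k + 1) p → IsPolyLT k fun x => segmentAverage ξ p x - p x
  | 0, p, hp => fun x => by
    obtain ⟨c, rfl⟩ : ∃ c, p = fun _ => c := ⟨p 0, funext hp.eq_zero_apply⟩
    simp only [segmentAverage, intervalIntegral.integral_const, smul_eq_mul]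
    ring
  | k + 1, p, hp => by
    refine ⟨(hp.1.segmentAverage ξ).sub hp.1, fun v => ?_⟩
    convert segmentAverage_sub_self ξ (hp.2 v) using 2 with x
    rw [segmentAverage_sub (hp.1.comp_add v) hp.1, segmentAverage_comp_add]
    ring

/-- A tame function whose differences along a spanning set of lines have degree less than `k`
has degree less than `k + 1`. -/
theorem succ_of_span (hp : IsTame p) {X : Set (Fin d → ℝ)} (hX : Submodule.span ℝ X = ⊤)
    (h : ∀ ξ ∈ X, ∀ s : ℝ, IsPolyLT k fun x => p (x + s • ξ) - p x) : IsPolyLT (k + 1) p := by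
  refine ⟨hp, fun v => ?_⟩
  suffices ∀ s : ℝ, IsPolyLT k fun x => p (x + s • v) - p x by simpa using this 1
  have hv : v ∈ Submodule.span ℝ X := hX ▸ Submodule.mem_top
  induction hv using Submodule.span_induction with
  | mem ξ hξ => exact h ξ hξ
  | zero => intro s; simpa using zero k
  | add v w _ _ hv hw =>
    intro s
    convert ((hv s).comp_add (s • w)).add (hw s) using 2 with x
    rw [smul_add, add_assoc, add_comm (s • v)]
    ring
  | smul c v _ hv =>
    intro s
    simpa [smul_smul] using hv (s * c)

end IsPolyLT

/-- The real vector with the given integer coordinates. -/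
def intVec {d : ℕ} (j : Fin d → ℤ) : Fin d → ℝ := fun i => (j i : ℝ)

/-- The sum of the integer translates of `M` with coefficients `c`. -/
noncomputable def latticeSum {d : ℕ} (M : (Fin d → ℝ) → ℝ) (c : (Fin d → ℤ) → ℝ) :
    (Fin d → ℝ) → ℝ :=
  fun x => ∑ᶠ j, c j * M (x - intVec j)

/-- A bounded measurable function with bounded support. -/
structure IsKernel {d : ℕ} (M : (Fin d → ℝ) → ℝ) : Prop where
  measurable : Measurable M
  bounded : ∃ K : ℝ, ∀ x, |M x| ≤ K
  support : ∃ ρ : ℝ, ∀ x, ρ < ‖x‖ → M x = 0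

/-- The integer points with coordinates of absolute value at most `N`. -/
noncomputable def latticeBox (d N : ℕ) : Finset (Fin d → ℤ) :=
  Finset.Icc (fun _ => -(N : ℤ)) fun _ => (N : ℤ)

section lattice

variable {d : ℕ} {M : (Fin d → ℝ) → ℝ}

theorem intVec_add (j n : Fin d → ℤ) : intVec (j + n) = intVec j + intVec n := by
  ext i; simp [intVec]

theorem mem_latticeBox {N : ℕ} {j : Fin d → ℤ} (h : ‖intVec j‖ ≤ N) : j ∈ latticeBox d N := by
  have hj : ∀ i, |j i| ≤ N := fun i => by
    have := (norm_le_pi_norm (intVec j) i).trans h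
    rw [intVec, Real.norm_eq_abs] at this
    exact_mod_cast this
  exact Finset.mem_Icc.2 ⟨fun i => (abs_le.1 (hj i)).1, fun i => (abs_le.1 (hj i)).2⟩

theorem eq_zero_of_notMem_latticeBox {ρ : ℝ} (hρ : ∀ x, ρ < ‖x‖ → M x = 0) {N : ℕ}
    {x : Fin d → ℝ} (hN : ρ + ‖x‖ ≤ N) {j : Fin d → ℤ} (hj : j ∉ latticeBox d N) :
    M (x - intVec j) = 0 := by
  refine hρ _ ?_
  have h₁ : (N : ℝ) < ‖intVec j‖ := not_le.1 fun h => hj (mem_latticeBox h)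
  have h₂ := norm_sub_norm_le (intVec j) x
  rw [norm_sub_rev] at h₂
  linarith

theorem latticeSum_eq_sum {x : Fin d → ℝ} {T : Finset (Fin d → ℤ)}
    (hT : ∀ j ∉ T, M (x - intVec j) = 0) (c : (Fin d → ℤ) → ℝ) :
    latticeSum M c x = ∑ j ∈ T, c j * M (x - intVec j) := by
  refine finsum_eq_sum_of_support_subset _ fun j hj => ?_
  by_contra h
  exact hj (by simp [hT j h])

theorem latticeSum_eq_sum_latticeBox {ρ : ℝ} (hρ : ∀ x, ρ < ‖x‖ → M x = 0) {N : ℕ}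
    {x : Fin d → ℝ} (hN : ρ + ‖x‖ ≤ N) (c : (Fin d → ℤ) → ℝ) :
    latticeSum M c x = ∑ j ∈ latticeBox d N, c j * M (x - intVec j) :=
  latticeSum_eq_sum (fun _ hj => eq_zero_of_notMem_latticeBox hρ hN hj) c

theorem latticeSum_comp_add (M : (Fin d → ℝ) → ℝ) (c : (Fin d → ℤ) → ℝ) (n : Fin d → ℤ)
    (x : Fin d → ℝ) :
    latticeSum M (fun j => c (j + n)) x = latticeSum M c (x + intVec n) := by
  unfold latticeSum
  rw [← finsum_comp_equiv (Equiv.addRight n) (f := fun j => c j * M (x + intVec n - intVec j))]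
  simp [intVec_add]

namespace IsKernel

theorem isTame (hM : IsKernel M) : IsTame M where
  measurable := hM.measurable
  bounded _ := let ⟨K, hK⟩ := hM.bounded; ⟨K, fun x _ => hK x⟩

theorem exists_finset (hM : IsKernel M) (R : ℝ) :
    ∃ T : Finset (Fin d → ℤ), ∀ x, ‖x‖ ≤ R → ∀ j ∉ T, M (x - intVec j) = 0 := by
  obtain ⟨ρ, hρ⟩ := hM.support
  obtain ⟨N, hN⟩ := exists_nat_ge (ρ + R)
  exact ⟨latticeBox d N, fun x hx j hj =>
    eq_zero_of_notMem_latticeBox hρ (le_trans (by gcongr) hN) hj⟩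

theorem latticeSum_sub (hM : IsKernel M) (c₁ c₂ : (Fin d → ℤ) → ℝ) (x : Fin d → ℝ) :
    latticeSum M (fun j => c₁ j - c₂ j) x = latticeSum M c₁ x - latticeSum M c₂ x := by
  obtain ⟨T, hT⟩ := hM.exists_finset ‖x‖
  simp only [latticeSum_eq_sum (hT x le_rfl), sub_mul, Finset.sum_sub_distrib]

theorem latticeSum_const (hM : IsKernel M) (c : ℝ) (x : Fin d → ℝ) :
    latticeSum M (fun _ => c) x = c * latticeSum M (fun _ => 1) x := by
  obtain ⟨T, hT⟩ := hM.exists_finset ‖x‖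
  simp only [latticeSum_eq_sum (hT x le_rfl), one_mul, Finset.mul_sum]

theorem isTame_latticeSum (hM : IsKernel M) (c : (Fin d → ℤ) → ℝ) :
    IsTame (latticeSum M c) where
  measurable := by
    obtain ⟨ρ, hρ⟩ := hM.support
    refine measurable_of_tendsto_metrizable
      (f := fun (N : ℕ) x => ∑ j ∈ latticeBox d N, c j * M (x - intVec j)) (fun N => ?_)
      (tendsto_pi_nhds.2 fun x => ?_)
    · exact Finset.measurable_fun_sum _ fun j _ =>
        (hM.measurable.comp (by fun_prop)).const_mul _
    · obtain ⟨N, hN⟩ := exists_nat_ge (ρ + ‖x‖)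
      refine tendsto_atTop_of_eventually_const (i₀ := N) fun n hn => ?_
      exact (latticeSum_eq_sum_latticeBox hρ (hN.trans (by exact_mod_cast hn)) c).symm
  bounded R := by
    obtain ⟨K, hK⟩ := hM.bounded
    obtain ⟨T, hT⟩ := hM.exists_finset R
    refine ⟨∑ j ∈ T, |c j| * K, fun x hx => ?_⟩
    rw [latticeSum_eq_sum (hT x hx)]
    refine (Finset.abs_sum_le_sum_abs _ _).trans (Finset.sum_le_sum fun j _ => ?_)
    rw [abs_mul]
    gcongr
    exact hK _

theorem segmentAverage (hM : IsKernel M) (ξ : Fin d → ℝ) : IsKernel (segmentAverage ξ M) where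
  measurable := (hM.isTame.segmentAverage ξ).measurable
  bounded := by
    obtain ⟨K, hK⟩ := hM.bounded
    refine ⟨K, fun x => ?_⟩
    have := intervalIntegral.norm_integral_le_of_norm_le_const (a := -(1 : ℝ) / 2) (b := 1 / 2)
      (f := fun t : ℝ => M (x - t • ξ)) fun t _ => hK _
    rwa [show (1 / 2 : ℝ) - -1 / 2 = 1 by norm_num, abs_one, mul_one] at this
  support := by
    obtain ⟨ρ, hρ⟩ := hM.support
    refine ⟨ρ + ‖ξ‖, fun x hx => ?_⟩
    refine (intervalIntegral.integral_congr (g := fun _ => (0 : ℝ)) fun t ht => ?_).trans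
      intervalIntegral.integral_zero
    refine hρ _ ?_
    rw [Set.uIcc_of_le (by norm_num)] at ht
    have h₁ : ‖t • ξ‖ ≤ ‖ξ‖ := by
      rw [norm_smul, Real.norm_eq_abs]
      exact mul_le_of_le_one_left (norm_nonneg _) (abs_le.2 ⟨by linarith [ht.1], by linarith [ht.2]⟩)
    linarith [norm_sub_norm_le x (t • ξ)]

theorem latticeSum_segmentAverage (hM : IsKernel M) (ξ : Fin d → ℝ) (c : (Fin d → ℤ) → ℝ) :
    latticeSum (_root_.segmentAverage ξ M) c = _root_.segmentAverage ξ (latticeSum M c) := by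
  ext x
  obtain ⟨T₁, hT₁⟩ := (hM.segmentAverage ξ).exists_finset ‖x‖
  obtain ⟨T₂, hT₂⟩ := hM.exists_finset (‖x‖ + ‖ξ‖)
  have hT₂' : ∀ t ∈ Set.uIcc (-(1 : ℝ) / 2) (1 / 2), ∀ j ∉ T₁ ∪ T₂,
      M (x - t • ξ - intVec j) = 0 := by
    intro t ht j hj
    refine hT₂ _ ((norm_sub_le _ _).trans ?_) j (by simp_all)
    rw [Set.uIcc_of_le (by norm_num)] at ht
    rw [norm_smul, Real.norm_eq_abs]
    gcongr
    exact mul_le_of_le_one_left (norm_nonneg _) (abs_le.2 ⟨by linarith [ht.1], by linarith [ht.2]⟩)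
  rw [latticeSum_eq_sum (T := T₁ ∪ T₂) fun j hj => hT₁ x le_rfl j (by simp_all)]
  refine Eq.trans ?_ (intervalIntegral.integral_congr fun t ht =>
    (latticeSum_eq_sum (hT₂' t ht) c)).symm
  rw [intervalIntegral.integral_finsetSum]
  · simp only [intervalIntegral.integral_const_mul, _root_.segmentAverage, sub_right_comm]
  · intro j _
    refine IntervalIntegrable.const_mul ?_ _
    simpa [sub_eq_add_neg, add_right_comm] using
      hM.isTame.intervalIntegrable (x - intVec j) (-ξ) (-1 / 2) (1 / 2)

/-- The value of a lattice sum is controlled by nearby coefficients. -/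
theorem exists_abs_latticeSum_le (hM : IsKernel M) :
    ∃ ρ K : ℝ, 0 ≤ ρ ∧ 0 ≤ K ∧ ∀ (g : (Fin d → ℝ) → ℝ) (x : Fin d → ℝ) (B : ℝ),
      (∀ y, ‖y - x‖ ≤ ρ → |g y| ≤ B) → |latticeSum M (fun j => g (intVec j)) x| ≤ K * B := by
  obtain ⟨K, hK⟩ := hM.bounded
  obtain ⟨ρ, hρ⟩ := hM.support
  obtain ⟨T, hT⟩ := hM.exists_finset 1
  have hK0 : 0 ≤ K := (abs_nonneg _).trans (hK 0)
  refine ⟨max ρ 0, T.card * K, le_max_right _ _, by positivity, fun g x B hB => ?_⟩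
  set n : Fin d → ℤ := fun i => ⌊x i⌋
  have hn : ‖x - intVec n‖ ≤ 1 := (pi_norm_le_iff_of_nonneg zero_le_one).2 fun i => by
    have h₁ := Int.floor_le (x i)
    have h₂ := Int.lt_floor_add_one (x i)
    rw [Real.norm_eq_abs, abs_le]
    simp only [Pi.sub_apply, intVec, n]
    constructor <;> linarith
  have hB0 : 0 ≤ B := (abs_nonneg _).trans (hB x (by simp))
  have hx : latticeSum M (fun j => g (intVec j)) x =
      latticeSum M (fun j => g (intVec (j + n))) (x - intVec n) := by
    rw [latticeSum_comp_add M (fun j => g (intVec j)), sub_add_cancel]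
  rw [hx, latticeSum_eq_sum (hT _ hn)]
  refine (Finset.abs_sum_le_sum_abs _ _).trans ?_
  rw [mul_assoc, ← nsmul_eq_mul]
  refine Finset.sum_le_card_nsmul _ _ _ fun j _ => ?_
  rw [abs_mul, sub_sub, add_comm (intVec n), ← intVec_add, mul_comm]
  by_cases hj : ‖x - intVec (j + n)‖ ≤ ρ
  · refine mul_le_mul (hK _) (hB _ ?_) (abs_nonneg _) hK0
    rw [norm_sub_rev]
    exact hj.trans (le_max_left _ _)
  · rw [hρ _ (not_le.1 hj), abs_zero, zero_mul]
    positivity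

end IsKernel

end lattice

/-- `M` is a partition of unity that arises by averaging `k` times in succession, at each step
along every direction of some spanning set of integer vectors. -/
def IsAveraged {d : ℕ} : ℕ → ((Fin d → ℝ) → ℝ) → Prop
  | 0, M => IsKernel M ∧ ∀ x, latticeSum M (fun _ => 1) x = 1
  | k + 1, M => (IsKernel M ∧ ∀ x, latticeSum M (fun _ => 1) x = 1) ∧
      ∃ X : Set (Fin d → ℤ), Submodule.span ℝ (intVec '' X) = ⊤ ∧
        ∀ ξ ∈ X, ∃ M', IsAveraged k M' ∧ M = segmentAverage (intVec ξ) M'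

namespace IsAveraged

variable {d k : ℕ} {M p : (Fin d → ℝ) → ℝ}

theorem isKernel : ∀ {k : ℕ}, IsAveraged k M → IsKernel M
  | 0, h => h.1
  | _ + 1, h => h.1.1

theorem of_succ : ∀ {k : ℕ} {M : (Fin d → ℝ) → ℝ}, IsAveraged (k + 1) M → IsAveraged k M
  | 0, _, h => h.1
  | _ + 1, _, ⟨h, X, hX, hM⟩ => ⟨h, X, hX, fun ξ hξ =>
      let ⟨M', h', e⟩ := hM ξ hξ; ⟨M', of_succ h', e⟩⟩

theorem mono {l : ℕ} (hkl : k ≤ l) (h : IsAveraged l M) : IsAveraged k M := by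
  induction l, hkl using Nat.le_induction with
  | base => exact h
  | succ _ _ ih => exact ih h.of_succ

/-- Sampling a polynomial of degree at most `k` changes it by a polynomial of smaller degree. -/
theorem latticeSum_sub_self : ∀ {k : ℕ} {M p : (Fin d → ℝ) → ℝ}, IsAveraged k M →
    IsPolyLT (k + 1) p → IsPolyLT k fun x => latticeSum M (fun j => p (intVec j)) x - p x
  | 0, M, p, hM, hp => fun x => by
    obtain ⟨c, rfl⟩ : ∃ c, p = fun _ => c := ⟨p 0, funext hp.eq_zero_apply⟩
    change latticeSum M (fun _ => c) x - c = 0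
    rw [hM.1.latticeSum_const, hM.2 x]
    ring
  | k + 1, M, p, hM, hp => by
    obtain ⟨hK, X, hX, hav⟩ := hM
    refine .succ_of_span ((hK.1.isTame_latticeSum _).sub hp.isTame) hX ?_
    rintro _ ⟨ξ, hξ, rfl⟩ s
    obtain ⟨M', hM', rfl⟩ := hav ξ hξ
    have hT := hM'.isKernel.isTame_latticeSum fun j => p (intVec j)
    have hG := latticeSum_sub_self hM' (hp.2 (intVec ξ))
    have h₁ := (((hG.integral (intVec ξ) (-(1 : ℝ) / 2) (s - 1 / 2))).add
      ((IsPolyLT.segmentAverage_sub_self (intVec ξ) hp).2 (s • intVec ξ)))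
    convert h₁ using 2 with x
    have h₂ := segmentAverage_add_smul_sub (hT.sub hp.isTame) (intVec ξ) x s
    rw [segmentAverage_sub hT hp.isTame, segmentAverage_sub hT hp.isTame] at h₂
    have h₃ : ∀ y, latticeSum M' (fun j => p (intVec j + intVec ξ) - p (intVec j)) y =
        latticeSum M' (fun j => p (intVec j)) (y + intVec ξ) -
          latticeSum M' (fun j => p (intVec j)) y := fun y => by
      rw [hM'.isKernel.latticeSum_sub, ← latticeSum_comp_add]
      simp only [intVec_add]
    simp only [hM'.isKernel.latticeSum_segmentAverage, h₃]
    have h₄ : ∀ y, latticeSum M' (fun j => p (intVec j)) (y + intVec ξ) -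
          latticeSum M' (fun j => p (intVec j)) y - (p (y + intVec ξ) - p y) =
        latticeSum M' (fun j => p (intVec j)) (y + intVec ξ) - p (y + intVec ξ) -
          (latticeSum M' (fun j => p (intVec j)) y - p y) := fun y => by ring
    simp only [h₄, ← h₂]
    ring

end IsAveraged

/-- The error `g - ∑ g(j) M(· - j)` of sampling at the integer points. -/
noncomputable def samplingError {d : ℕ} (M g : (Fin d → ℝ) → ℝ) : (Fin d → ℝ) → ℝ :=
  fun x => g x - latticeSum M (fun j => g (intVec j)) x

section samplingError

variable {d : ℕ} {M : (Fin d → ℝ) → ℝ}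

theorem exists_coeff_iterate_samplingError (hM : IsKernel M) (g : (Fin d → ℝ) → ℝ) (k : ℕ) :
    ∃ c : (Fin d → ℤ) → ℝ, ∀ x, g x - latticeSum M c x = (samplingError M)^[k] g x := by
  induction k with
  | zero => exact ⟨fun _ => 0, fun x => by simp [latticeSum]⟩
  | succ k ih =>
    obtain ⟨c, hc⟩ := ih
    refine ⟨fun j => c j - -(samplingError M)^[k] g (intVec j), fun x => ?_⟩
    have h₀ := hM.latticeSum_sub (fun _ => 0) (fun j => (samplingError M)^[k] g (intVec j)) x
    rw [hM.latticeSum_const 0] at h₀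
    rw [hM.latticeSum_sub, Function.iterate_succ_apply', samplingError, ← hc]
    simp only [zero_sub, zero_mul] at h₀
    rw [h₀]
    ring

theorem iterate_samplingError_sub (hM : IsKernel M) (g₁ g₂ : (Fin d → ℝ) → ℝ) (k : ℕ) :
    (samplingError M)^[k] (fun x => g₁ x - g₂ x) =
      fun x => (samplingError M)^[k] g₁ x - (samplingError M)^[k] g₂ x := by
  induction k with
  | zero => rfl
  | succ k ih =>
    ext x
    simp only [Function.iterate_succ_apply', ih, samplingError, hM.latticeSum_sub]
    ring

theorem IsPolyLT.samplingError {k : ℕ} (hM : IsAveraged k M) {p : (Fin d → ℝ) → ℝ}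
    (hp : IsPolyLT (k + 1) p) : IsPolyLT k (samplingError M p) := by
  convert (hM.latticeSum_sub_self hp).const_mul (-1) using 2 with x
  simp [_root_.samplingError]

theorem IsPolyLT.iterate_samplingError_eq_zero {k : ℕ} (hM : IsAveraged k M) :
    ∀ {l : ℕ} {p : (Fin d → ℝ) → ℝ}, l ≤ k + 1 → IsPolyLT l p →
      ∀ x, (_root_.samplingError M)^[l] p x = 0
  | 0, _, _, hp => hp
  | l + 1, p, hl, hp => by
    rw [Function.iterate_succ]
    exact iterate_samplingError_eq_zero hM (by omega) (hp.samplingError (hM.mono (by omega)))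

theorem IsKernel.exists_abs_iterate_samplingError_le (hM : IsKernel M) (k : ℕ) :
    ∃ ρ K : ℝ, 0 ≤ ρ ∧ 0 ≤ K ∧ ∀ (g : (Fin d → ℝ) → ℝ) (x : Fin d → ℝ) (B : ℝ),
      (∀ y, ‖y - x‖ ≤ ρ → |g y| ≤ B) → |(samplingError M)^[k] g x| ≤ K * B := by
  obtain ⟨ρ₁, K₁, hρ₁, hK₁, h₁⟩ := hM.exists_abs_latticeSum_le
  induction k with
  | zero =>
    exact ⟨0, 1, le_rfl, zero_le_one, fun g x B h => by simpa using h x (by simp)⟩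
  | succ k ih =>
    obtain ⟨ρ, K, hρ, hK, h⟩ := ih
    refine ⟨ρ + ρ₁, (1 + K₁) * K, by positivity, by positivity, fun g x B hB => ?_⟩
    have hy : ∀ y, ‖y - x‖ ≤ ρ₁ → |(samplingError M)^[k] g y| ≤ K * B := fun y hy =>
      h g y B fun z hz => hB z <| by
        rw [← sub_add_sub_cancel z y x]
        exact (norm_add_le _ _).trans (add_le_add hz hy)
    rw [Function.iterate_succ_apply', samplingError]
    calc |_| ≤ _ := abs_sub _ _
      _ ≤ K * B + K₁ * (K * B) := add_le_add (hy x (by simpa using hρ₁)) (h₁ _ x _ hy)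
      _ = _ := by ring

end samplingError

section Taylor

variable {d : ℕ}

theorem IsPolyLT.multilinear_diag {k : ℕ} (a : MultilinearMap ℝ (fun _ : Fin k => Fin d → ℝ) ℝ) :
    IsPolyLT (k + 1) fun x => a fun _ => x := by
  classical
  have h : (fun x => a fun _ => x) = fun x : Fin d → ℝ => ∑ r : Fin k → Fin d,
      a (fun l => Pi.single (r l) 1) * ∏ l, x (r l) := by
    ext x
    have hx : (fun _ : Fin k => x) = fun _ => ∑ i, x i • (Pi.single i 1 : Fin d → ℝ) := by
      ext _ j; simp [Finset.sum_apply, Pi.single_apply]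
    rw [hx, MultilinearMap.map_sum]
    refine Finset.sum_congr rfl fun r _ => ?_
    rw [MultilinearMap.map_smul_univ, smul_eq_mul, mul_comm]
  rw [h]
  refine .sum _ fun r hr => .const_mul _ ?_
  clear hr h a
  induction k with
  | zero => simpa using IsPolyLT.const 0 1
  | succ k ih =>
    simp only [Fin.prod_univ_succ]
    exact (ih fun l => r l.succ).coord_mul _

theorem iteratedDeriv_comp_line {f : (Fin d → ℝ) → ℝ} (hf : ContDiff ℝ (⊤ : ℕ∞) f)
    (a v : Fin d → ℝ) (k : ℕ) :
    iteratedDeriv k (fun t : ℝ => f (a + t • v)) =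
      fun t => iteratedFDeriv ℝ k f (a + t • v) fun _ => v := by
  induction k with
  | zero => ext; simp
  | succ k ih =>
    ext t
    rw [iteratedDeriv_succ, ih]
    have hd : HasFDerivAt (iteratedFDeriv ℝ k f) (fderiv ℝ (iteratedFDeriv ℝ k f) (a + t • v))
        (a + t • v) :=
      ((hf.differentiable_iteratedFDeriv (by exact_mod_cast ENat.natCast_lt_top k)) _).hasFDerivAt
    have hl : HasDerivAt (fun s : ℝ => a + s • v) v t := by
      simpa using ((hasDerivAt_id t).smul_const v).const_add a
    have := ((ContinuousMultilinearMap.apply ℝ (fun _ : Fin k => Fin d → ℝ) ℝ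
      fun _ => v).hasFDerivAt.comp_hasDerivAt t (hd.comp_hasDerivAt t hl))
    exact this.deriv

/-- Taylor's theorem: a smooth compactly supported function is approximated near every point by a
polynomial, uniformly in the point. -/
theorem exists_isPolyLT_abs_sub_le {f : (Fin d → ℝ) → ℝ} (hf : ContDiff ℝ (⊤ : ℕ∞) f)
    (hfc : HasCompactSupport f) (k : ℕ) :
    ∃ C : ℝ, 0 ≤ C ∧ ∀ a, ∃ p, IsPolyLT (k + 1) p ∧ ∀ y, |f y - p y| ≤ C * ‖y - a‖ ^ (k + 1) := by
  obtain ⟨C, hC⟩ := (hf.continuous_iteratedFDeriv (m := k + 1)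
    (by exact_mod_cast le_top)).bounded_above_of_compact_support (hfc.iteratedFDeriv (k + 1))
  have hC0 : 0 ≤ C := (norm_nonneg _).trans (hC 0)
  refine ⟨C, hC0, fun a => ?_⟩
  refine ⟨fun y => ∑ i ∈ Finset.range (k + 1), ((i.factorial : ℝ)⁻¹) *
    iteratedFDeriv ℝ i f a fun _ => y - a, .sum _ fun i hi => .const_mul _ ?_, fun y => ?_⟩
  · have := ((IsPolyLT.multilinear_diag (iteratedFDeriv ℝ i f a).toMultilinearMap).comp_add
      (-a)).mono (Nat.succ_le_succ (Finset.mem_range_succ_iff.1 hi))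
    simpa [sub_eq_add_neg] using this
  · set g : ℝ → ℝ := fun t => f (a + t • (y - a))
    have hg : ContDiff ℝ (⊤ : ℕ∞) g := hf.comp (by fun_prop)
    have hder := iteratedDeriv_comp_line hf a (y - a)
    have hwithin : ∀ i, ∀ t ∈ Set.Icc (0 : ℝ) 1,
        iteratedDerivWithin i g (Set.Icc 0 1) t = iteratedDeriv i g t := fun i t ht =>
      iteratedDerivWithin_eq_iteratedDeriv (uniqueDiffOn_Icc zero_lt_one)
        (hg.contDiffAt.of_le (by exact_mod_cast le_top)) ht
    have hmain := taylor_mean_remainder_bound (f := g) (a := 0) (b := 1) (x := 1) (n := k)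
      (C := C * ‖y - a‖ ^ (k + 1)) zero_le_one
      (hg.contDiffOn.of_le (by exact_mod_cast le_top)) (by simp) fun t ht => by
        rw [hwithin _ _ ht, hder]
        refine (ContinuousMultilinearMap.le_opNorm _ _).trans ?_
        simpa using mul_le_mul_of_nonneg_right (hC _) (by positivity)
    rw [taylor_within_apply] at hmain
    have hsum : ∑ i ∈ Finset.range (k + 1), (((i.factorial : ℝ)⁻¹ * (1 - 0) ^ i) •
        iteratedDerivWithin i g (Set.Icc 0 1) 0) = ∑ i ∈ Finset.range (k + 1),
        ((i.factorial : ℝ)⁻¹) * iteratedFDeriv ℝ i f a fun _ => y - a := by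
      refine Finset.sum_congr rfl fun i _ => ?_
      rw [hwithin i 0 (by simp), hder]
      simp
    rw [hsum] at hmain
    have hg1 : g 1 = f y := by simp [g]
    rw [hg1, Real.norm_eq_abs, sub_zero, one_pow, mul_one] at hmain
    refine hmain.trans (div_le_self (by positivity) ?_)
    exact_mod_cast Nat.factorial_pos k

end Taylor

/-- A function obtained by averaging `k` times yields approximation order `k + 1`. -/
theorem IsAveraged.approximation_order {d k : ℕ} {M : (Fin d → ℝ) → ℝ} (hM : IsAveraged k M)
    {f : (Fin d → ℝ) → ℝ} (hf : ContDiff ℝ (⊤ : ℕ∞) f) (hfc : HasCompactSupport f) :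
    ∃ C : ℝ, 0 < C ∧ ∀ h : ℝ, 0 < h → ∃ c : (Fin d → ℤ) → ℝ, ∀ x,
      |f x - latticeSum M c (h⁻¹ • x)| ≤ C * h ^ (k + 1) := by
  obtain ⟨C, hC, htaylor⟩ := exists_isPolyLT_abs_sub_le hf hfc k
  obtain ⟨ρ, K, hρ, hK, hloc⟩ := hM.isKernel.exists_abs_iterate_samplingError_le (k + 1)
  refine ⟨K * (C * ρ ^ (k + 1)) + 1, by positivity, fun h hh => ?_⟩
  obtain ⟨c, hc⟩ := exists_coeff_iterate_samplingError hM.isKernel (fun y => f (h • y)) (k + 1)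
  refine ⟨c, fun x => ?_⟩
  obtain ⟨p, hp, hfp⟩ := htaylor x
  have hpz := IsPolyLT.iterate_samplingError_eq_zero hM le_rfl (by simpa using hp.comp_smul_add h 0)
    (h⁻¹ • x)
  have hsub := congr_fun (iterate_samplingError_sub hM.isKernel (fun y => f (h • y))
    (fun y => p (h • y)) (k + 1)) (h⁻¹ • x)
  rw [hpz, sub_zero, ← hc, smul_inv_smul₀ hh.ne'] at hsub
  rw [← hsub]
  refine (hloc _ _ (C * (h * ρ) ^ (k + 1)) fun y hy => (hfp _).trans ?_).trans ?_
  · gcongr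
    rw [← smul_inv_smul₀ hh.ne' x, ← smul_sub, norm_smul, Real.norm_eq_abs, abs_of_pos hh]
    gcongr
  · rw [mul_pow]
    nlinarith [pow_pos hh (k + 1)]

/-- The half-open parallelepiped spanned by `b`, centered at the origin. -/
def centeredParallelepiped {d : ℕ} (b : Fin d → Fin d → ℝ) : Set (Fin d → ℝ) :=
  {y | ∃ t : Fin d → ℝ, (∀ i, t i ∈ Set.Ico (-(1 : ℝ) / 2) (1 / 2)) ∧ y = ∑ i, t i • b i}

/-- The normalized indicator function of the centered half-open parallelepiped spanned by `b`. -/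
noncomputable def parallelepipedSpline {d : ℕ} (b : Fin d → Fin d → ℝ) : (Fin d → ℝ) → ℝ :=
  (centeredParallelepiped b).indicator fun _ => |(Matrix.of b).det|⁻¹

section parallelepiped

variable {d : ℕ} {b : Fin d → Fin d → ℝ}

theorem linearIndependent_iff_det_ne_zero :
    LinearIndependent ℝ b ↔ (Matrix.of b).det ≠ 0 := by
  rw [← isUnit_iff_ne_zero, ← Matrix.isUnit_iff_isUnit_det,
    ← Matrix.linearIndependent_rows_iff_isUnit]
  rfl

theorem sum_smul_mem_centeredParallelepiped (hb : LinearIndependent ℝ b) (t : Fin d → ℝ) :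
    ∑ i, t i • b i ∈ centeredParallelepiped b ↔
      ∀ i, t i ∈ Set.Ico (-(1 : ℝ) / 2) (1 / 2) := by
  refine ⟨fun ⟨u, hu, e⟩ => ?_, fun h => ⟨t, h, rfl⟩⟩
  rwa [hb.fintypeLinearCombination_injective e]

theorem exists_dual (hb : LinearIndependent ℝ b) :
    ∃ a : Fin d → (Fin d → ℝ) →ₗ[ℝ] ℝ, (∀ i j, a i (b j) = if i = j then 1 else 0) ∧
      ∀ x, ∑ i, a i x • b i = x := by
  let B := basisOfLinearIndependentOfCardEqFinrank' b hb (by simp)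
  have hB : ∀ i, B i = b i := fun i => by simp [B]
  refine ⟨B.coord, fun i j => ?_, fun x => ?_⟩
  · rw [← hB, Module.Basis.coord_apply, Module.Basis.repr_self, Finsupp.single_apply]
    simp [eq_comm]
  · simpa [hB] using B.sum_repr x

theorem isKernel_parallelepipedSpline (hb : LinearIndependent ℝ b) :
    IsKernel (parallelepipedSpline b) where
  measurable := by
    obtain ⟨a, -, ha⟩ := exists_dual hb
    refine measurable_const.indicator ?_
    have : centeredParallelepiped b = ⋂ i, a i ⁻¹' Set.Ico (-(1 : ℝ) / 2) (1 / 2) := by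
      ext x
      conv_lhs => rw [← ha x]
      simp only [sum_smul_mem_centeredParallelepiped hb, Set.mem_iInter, Set.mem_preimage]
    rw [this]
    exact .iInter fun i => (a i).continuous_of_finiteDimensional.measurable measurableSet_Ico
  bounded := by
    refine ⟨|(Matrix.of b).det|⁻¹, fun x => ?_⟩
    rw [← Real.norm_eq_abs]
    refine (norm_indicator_le_norm_self _ _).trans (by simp)
  support := by
    refine ⟨∑ i, ‖b i‖, fun x hx => Set.indicator_of_notMem ?_ _⟩
    rintro ⟨t, ht, rfl⟩
    refine hx.not_ge ((norm_sum_le _ _).trans (Finset.sum_le_sum fun i _ => ?_))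
    rw [norm_smul, Real.norm_eq_abs]
    exact mul_le_of_le_one_left (norm_nonneg _)
      (abs_le.2 ⟨by linarith [(ht i).1], by linarith [(ht i).2]⟩)

theorem det_update (η : Fin d → ℝ) (c : Fin d → ℝ) (hη : ∑ i, c i • b i = η) (i : Fin d) :
    (Matrix.of (Function.update b i η)).det = c i * (Matrix.of b).det := by
  rw [← hη]
  exact Matrix.det_updateRow_sum (Matrix.of b) i c

theorem integral_half_eq (F : ℝ → ℝ) :
    ∫ t in (-(1 : ℝ) / 2)..(1 / 2), F t =
      ∫ t, (Set.Ico (-(1 : ℝ) / 2) (1 / 2)).indicator F t := by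
  rw [intervalIntegral.integral_of_le (by norm_num), integral_indicator measurableSet_Ico,
    integral_Ico_eq_integral_Ioo, integral_Ioc_eq_integral_Ioo]

/-- Averaging along `η` after averaging along the basis vectors can be done in the other order. -/
theorem segmentAverage_parallelepipedSpline_exchange (hb : LinearIndependent ℝ b)
    {c η : Fin d → ℝ} (hη : ∑ j, c j • b j = η) {i : Fin d} (hi : c i ≠ 0) :
    segmentAverage η (parallelepipedSpline b) =
      segmentAverage (b i) (parallelepipedSpline (Function.update b i η)) := by
  classical
  set I := Set.Ico (-(1 : ℝ) / 2) (1 / 2)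
  set D := |(Matrix.of b).det|
  have hdet := det_update η c hη i
  have hb' : LinearIndependent ℝ (Function.update b i η) := by
    rw [linearIndependent_iff_det_ne_zero, hdet]
    exact mul_ne_zero hi (linearIndependent_iff_det_ne_zero.1 hb)
  obtain ⟨a, -, ha⟩ := exists_dual hb
  ext x
  have h₁ : ∀ t : ℝ, x - t • η = ∑ j, (a j x - t * c j) • b j := fun t => by
    conv_lhs => rw [← ha x, ← hη]
    simp only [sub_smul, Finset.sum_sub_distrib, Finset.smul_sum, mul_smul]
  have h₂ : ∀ t : ℝ, x - (a i x - c i * t) • b i =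
      ∑ j, (Function.update (fun j => a j x - t * c j) i t) j • Function.update b i η j := by
    intro t
    have e : ∑ j, (Function.update (fun j => a j x - t * c j) i t) j • Function.update b i η j =
        t • η + ∑ j ∈ Finset.univ.erase i, (a j x - t * c j) • b j := by
      rw [← Finset.add_sum_erase _ _ (Finset.mem_univ i)]
      congr 1
      · simp
      · refine Finset.sum_congr rfl fun j hj => ?_
        have := Finset.ne_of_mem_erase hj
        simp [this]
    rw [e, ← sub_eq_iff_eq_add', sub_right_comm, h₁ t,
      ← Finset.add_sum_erase _ _ (Finset.mem_univ i)]
    module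
  set φ : ℝ → ℝ := {t | t ∈ I ∧ ∀ j, a j x - t * c j ∈ I}.indicator fun _ => 1
  have hL : ∀ t, I.indicator (fun t => parallelepipedSpline b (x - t • η)) t = D⁻¹ * φ t := by
    intro t
    simp only [parallelepipedSpline, Set.indicator_apply, h₁,
      sum_smul_mem_centeredParallelepiped hb, φ, Set.mem_ofPred_eq]
    rw [← ite_and]
    simp only [mul_ite, mul_one, mul_zero, I, D]
  have hR : ∀ t, I.indicator
      (fun s => parallelepipedSpline (Function.update b i η) (x - s • b i)) (a i x - c i * t) =
        (|c i| * D)⁻¹ * φ t := by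
    intro t
    simp only [parallelepipedSpline, Set.indicator_apply, h₂,
      sum_smul_mem_centeredParallelepiped hb', φ, Set.mem_ofPred_eq, hdet, abs_mul]
    have : (a i x - c i * t ∈ I ∧ ∀ j, Function.update (fun j => a j x - t * c j) i t j ∈ I) ↔
        (t ∈ I ∧ ∀ j, a j x - t * c j ∈ I) := by
      constructor
      · rintro ⟨p, q⟩
        refine ⟨by simpa using q i, fun j => ?_⟩
        by_cases hj : j = i
        · subst hj; rwa [mul_comm]
        · simpa [hj] using q j
      · rintro ⟨p, q⟩
        refine ⟨mul_comm t (c i) ▸ q i, fun j => ?_⟩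
        by_cases hj : j = i
        · subst hj; simpa using p
        · simpa [hj] using q j
    rw [← ite_and]
    simp only [I] at this ⊢
    simp only [this, mul_ite, mul_one, mul_zero, D]
  have hsub := integral_sub_left_eq_self (fun s => I.indicator
      (fun s => parallelepipedSpline (Function.update b i η) (x - s • b i)) s) volume (a i x)
  have hscale := Measure.integral_comp_mul_left (fun s => I.indicator
      (fun s => parallelepipedSpline (Function.update b i η) (x - s • b i)) (a i x - s)) (c i)
  simp only [hR] at hscale
  rw [segmentAverage, segmentAverage, integral_half_eq, integral_half_eq, ← hsub]
  simp only [I] at hL hscale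
  simp only [hL]
  rw [integral_const_mul] at hscale ⊢
  have hc : |c i| ≠ 0 := abs_ne_zero.2 hi
  rw [smul_eq_mul, abs_inv, mul_inv, mul_assoc] at hscale
  exact mul_left_cancel₀ (inv_ne_zero hc) hscale

end parallelepiped

section partitionOfUnity

variable {d : ℕ} {b : Fin d → Fin d → ℤ}

theorem intVec_sum_smul {ι : Type*} (s : Finset ι) (n : ι → ℤ) (v : ι → Fin d → ℤ) :
    intVec (∑ i ∈ s, n i • v i) = ∑ i ∈ s, (n i : ℝ) • intVec (v i) := by
  ext j
  simp [intVec, Finset.sum_apply]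

/-- Each translate of the parallelepiped contains exactly `|det b|` integer points. -/
theorem card_intVec_mem_centeredParallelepiped
    (hb : LinearIndependent ℝ fun i => intVec (b i)) (x : Fin d → ℝ) :
    Nat.card {j : Fin d → ℤ // x - intVec j ∈ centeredParallelepiped fun i => intVec (b i)} =
      (Matrix.of b).det.natAbs := by
  have hbZ : LinearIndependent ℤ b := by
    rw [Fintype.linearIndependent_iff] at hb ⊢
    intro n hn i
    have := hb (fun i => (n i : ℝ)) (by
      rw [← intVec_sum_smul, hn]; ext; simp [intVec]) i
    exact_mod_cast this
  obtain ⟨a, -, ha⟩ := exists_dual hb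
  have hdet := Submodule.natAbs_det_basis_change (Pi.basisFun ℤ (Fin d))
    (Submodule.span ℤ (Set.range b)) (Module.Basis.span hbZ)
  have hcoe : (Subtype.val ∘ Module.Basis.span hbZ : Fin d → Fin d → ℤ) = b := by
    ext i : 1
    simp [Module.Basis.span_apply]
  rw [hcoe, Pi.basisFun_det] at hdet
  change (Matrix.of b).det.natAbs = _ at hdet
  rw [hdet]
  refine Nat.card_congr (Equiv.ofBijective (fun j => Submodule.Quotient.mk j.1) ⟨?_, ?_⟩)
  · rintro ⟨j, hj⟩ ⟨k, hk⟩ h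
    obtain ⟨n, hn⟩ := (Submodule.mem_span_range_iff_exists_fun ℤ).1
      ((Submodule.Quotient.eq _).1 h)
    obtain ⟨t, ht, et⟩ := hj
    obtain ⟨u, hu, eu⟩ := hk
    have e : (fun i => (n i : ℝ)) = u - t := by
      refine hb.fintypeLinearCombination_injective ?_
      simp only [Fintype.linearCombination_apply, Pi.sub_apply, sub_smul, Finset.sum_sub_distrib,
        ← et, ← eu, ← intVec_sum_smul, hn]
      ext i
      simp [intVec]
    have hn0 : n = 0 := funext fun i => by
      have hi : (n i : ℝ) = u i - t i := congr_fun e i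
      have h₁ : (n i : ℝ) < 1 := by linarith [(hu i).2, (ht i).1]
      have h₂ : (-1 : ℝ) < n i := by linarith [(hu i).1, (ht i).2]
      have h₃ : n i < 1 := by exact_mod_cast h₁
      have h₄ : -1 < n i := by exact_mod_cast h₂
      simp only [Pi.zero_apply]
      omega
    subst hn0
    simp only [Pi.zero_apply, zero_smul, Finset.sum_const_zero] at hn
    exact Subtype.ext (sub_eq_zero.1 hn.symm)
  · intro q
    obtain ⟨j, rfl⟩ := Submodule.Quotient.mk_surjective _ q
    set n : Fin d → ℤ := fun i => ⌊a i (x - intVec j) + 1 / 2⌋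
    refine ⟨⟨j + ∑ i, n i • b i, fun i => a i (x - intVec j) - n i, fun i => ?_, ?_⟩, ?_⟩
    · have h₁ := Int.floor_le (a i (x - intVec j) + 1 / 2)
      have h₂ := Int.lt_floor_add_one (a i (x - intVec j) + 1 / 2)
      constructor <;> simp only [n] <;> linarith
    · simp only [intVec_add, intVec_sum_smul, sub_smul, Finset.sum_sub_distrib, ha]
      abel
    · refine (Submodule.Quotient.eq _).2 ?_
      rw [add_sub_cancel_left]
      exact (Submodule.mem_span_range_iff_exists_fun ℤ).2 ⟨n, rfl⟩

theorem latticeSum_parallelepipedSpline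
    (hb : LinearIndependent ℝ fun i => intVec (b i)) (x : Fin d → ℝ) :
    latticeSum (parallelepipedSpline fun i => intVec (b i)) (fun _ => 1) x = 1 := by
  classical
  have hdet : (Matrix.of fun i => intVec (b i)).det = ((Matrix.of b).det : ℝ) := by
    rw [Int.cast_det]; rfl
  have hne := linearIndependent_iff_det_ne_zero.1 hb
  have hcard := card_intVec_mem_centeredParallelepiped hb x
  set J : Set (Fin d → ℤ) := {j | x - intVec j ∈ centeredParallelepiped fun i => intVec (b i)}
  have hJ : J.Finite := Nat.finite_of_card_ne_zero (α := J) <| by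
    rw [hdet] at hne
    refine fun h => hne ?_
    rw [Int.natAbs_eq_zero.1 (hcard.symm.trans h), Int.cast_zero]
  have hc : (hJ.toFinset.card : ℝ) = |(Matrix.of fun i => intVec (b i)).det| := by
    rw [hdet, ← Int.cast_abs, Int.abs_eq_natAbs, ← hcard, ← Set.ncard_eq_toFinset_card J hJ]
    rfl
  have hout : ∀ j ∉ hJ.toFinset, parallelepipedSpline (fun i => intVec (b i)) (x - intVec j) = 0 :=
    fun j hj => Set.indicator_of_notMem (by simpa [J] using hj) _
  rw [latticeSum_eq_sum hout,
    Finset.sum_congr rfl (g := fun _ => |(Matrix.of fun i => intVec (b i)).det|⁻¹) fun j hj => ?_]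
  · rw [Finset.sum_const, nsmul_eq_mul, hc, mul_inv_cancel₀ (abs_ne_zero.2 hne)]
  · rw [one_mul]
    exact Set.indicator_of_mem (by simpa [J] using hj) _

end partitionOfUnity

section commute

variable {d : ℕ} {M : (Fin d → ℝ) → ℝ}

theorem segmentAverage_comm (hM : IsKernel M) (ξ η : Fin d → ℝ) :
    segmentAverage ξ (segmentAverage η M) = segmentAverage η (segmentAverage ξ M) := by
  ext x
  obtain ⟨K, hK⟩ := hM.bounded
  have hmeas : Measurable (Function.uncurry fun s t : ℝ => M (x - s • ξ - t • η)) :=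
    hM.measurable.comp (by fun_prop)
  have hvol : volume (Set.uIoc (-(1 : ℝ) / 2) (1 / 2) ×ˢ Set.uIoc (-(1 : ℝ) / 2) (1 / 2)) ≠ ⊤ := by
    rw [Measure.volume_eq_prod, Measure.prod_prod, Set.uIoc_of_le (by norm_num)]
    exact ENNReal.mul_ne_top (by simp) (by simp)
  have := intervalIntegral_intervalIntegral_swap
    (Measure.integrableOn_of_bounded (M := K) hvol hmeas.aestronglyMeasurable
      (.of_forall fun z => hK _))
  simp only [segmentAverage]
  rw [this]
  simp only [sub_right_comm x]

end commute

/-- The function `M` averaged successively along all directions of the list. -/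
noncomputable def averages {d : ℕ} (L : List (Fin d → ℤ)) (M : (Fin d → ℝ) → ℝ) :
    (Fin d → ℝ) → ℝ :=
  L.foldr (fun ξ g => segmentAverage (intVec ξ) g) M

section averages

variable {d : ℕ} {M : (Fin d → ℝ) → ℝ}

theorem averages_append (L₁ L₂ : List (Fin d → ℤ)) :
    averages (L₁ ++ L₂) M = averages L₁ (averages L₂ M) :=
  List.foldr_append

theorem IsKernel.averages (hM : IsKernel M) : ∀ L, IsKernel (averages L M)
  | [] => hM
  | ξ :: L => (hM.averages L).segmentAverage (intVec ξ)

theorem latticeSum_averages (hM : IsKernel M) (h : ∀ x, latticeSum M (fun _ => 1) x = 1) :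
    ∀ L x, latticeSum (averages L M) (fun _ => 1) x = 1
  | [], x => h x
  | ξ :: L, x => by
    change latticeSum (segmentAverage (intVec ξ) (averages L M)) _ x = 1
    rw [(hM.averages L).latticeSum_segmentAverage]
    simp only [segmentAverage, latticeSum_averages hM h L]
    norm_num

theorem averages_segmentAverage (hM : IsKernel M) (η : Fin d → ℝ) :
    ∀ L, averages L (segmentAverage η M) = segmentAverage η (averages L M)
  | [] => rfl
  | ξ :: L => by
    change segmentAverage (intVec ξ) (averages L _) =
      segmentAverage η (segmentAverage (intVec ξ) (averages L M))
    rw [averages_segmentAverage hM η L, segmentAverage_comm (hM.averages L)]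

theorem averages_middle (hM : IsKernel M) (L₁ L₂ : List (Fin d → ℤ)) (η : Fin d → ℤ) :
    averages (L₁ ++ η :: L₂) M = averages (L₁ ++ L₂) (segmentAverage (intVec η) M) := by
  rw [averages_append, averages_append, averages_segmentAverage hM]
  rfl

end averages

/-- The indicator function of the integer points outside the kernel of `ℓ`. -/
noncomputable def offKernel {d : ℕ} (ℓ : (Fin d → ℝ) →ₗ[ℝ] ℝ) (ξ : Fin d → ℤ) : ℕ :=
  open Classical in if ℓ (intVec ξ) = 0 then 0 else 1

theorem offKernel_le_one {d : ℕ} (ℓ : (Fin d → ℝ) →ₗ[ℝ] ℝ) (ξ : Fin d → ℤ) :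
    offKernel ℓ ξ ≤ 1 := by
  unfold offKernel; split_ifs <;> simp

/-- If every nonzero functional is nonzero on more than `k` of the directions, then the
iterated average of the parallelepiped spline is `k`-fold averaged. -/
theorem isAveraged_averages {d : ℕ} : ∀ {k : ℕ} {b : Fin d → Fin d → ℤ} {L : List (Fin d → ℤ)},
    LinearIndependent ℝ (fun i => intVec (b i)) →
    (∀ ℓ : (Fin d → ℝ) →ₗ[ℝ] ℝ, ℓ ≠ 0 →
      k + 1 ≤ ∑ i, offKernel ℓ (b i) + (L.map (offKernel ℓ)).sum) →
    IsAveraged k (averages L (parallelepipedSpline fun i => intVec (b i)))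
  | 0, b, L, hb, _ => by
    have hM := isKernel_parallelepipedSpline hb
    exact ⟨hM.averages L, latticeSum_averages hM (latticeSum_parallelepipedSpline hb) L⟩
  | k + 1, b, L, hb, hL => by
    classical
    have hM := isKernel_parallelepipedSpline hb
    refine ⟨⟨hM.averages L, latticeSum_averages hM (latticeSum_parallelepipedSpline hb) L⟩,
      Set.range b, ?_, ?_⟩
    · rw [← Set.range_comp]
      exact hb.span_eq_top_of_card_eq_finrank' (by simp)
    · rintro _ ⟨i, rfl⟩
      obtain ⟨a, hab, ha⟩ := exists_dual hb
      have hai : a i ≠ 0 := fun h => by simpa [h] using hab i i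
      have hbi : ∑ j, offKernel (a i) (b j) = 1 := by simp [offKernel, hab]
      obtain ⟨η, hη, hηi⟩ : ∃ η ∈ L, a i (intVec η) ≠ 0 := by
        by_contra! h
        have : (L.map (offKernel (a i))).sum = 0 :=
          List.sum_eq_zero fun n hn => by
            obtain ⟨η, hη, rfl⟩ := List.mem_map.1 hn
            simp [offKernel, h η hη]
        have := hL _ hai
        omega
      obtain ⟨L₁, L₂, rfl⟩ := List.append_of_mem hη
      have hupd : (fun j => intVec (Function.update b i η j)) =
          Function.update (fun j => intVec (b j)) i (intVec η) :=
        funext fun j => by by_cases h : j = i <;> [subst h; skip] <;> simp [*]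
      have hb' : LinearIndependent ℝ fun j => intVec (Function.update b i η j) := by
        rw [hupd, linearIndependent_iff_det_ne_zero,
          det_update (intVec η) (fun j => a j (intVec η)) (ha _)]
        exact mul_ne_zero hηi (linearIndependent_iff_det_ne_zero.1 hb)
      refine ⟨_, isAveraged_averages (L := L₁ ++ L₂) hb' fun ℓ hℓ => ?_, ?_⟩
      · have h := hL ℓ hℓ
        have hi := offKernel_le_one ℓ (b i)
        have hsum : ∑ j ∈ Finset.univ.erase i, offKernel ℓ (Function.update b i η j) =
            ∑ j ∈ Finset.univ.erase i, offKernel ℓ (b j) :=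
          Finset.sum_congr rfl fun j hj => by rw [Function.update_of_ne (Finset.ne_of_mem_erase hj)]
        rw [← Finset.add_sum_erase _ _ (Finset.mem_univ i)] at h ⊢
        rw [hsum, Function.update_self]
        simp only [List.map_append, List.map_cons, List.sum_append, List.sum_cons] at h ⊢
        omega
      · rw [averages_middle hM, segmentAverage_parallelepipedSpline_exchange hb (ha _) hηi, ← hupd,
          averages_segmentAverage (isKernel_parallelepipedSpline hb')]

/-- An integer box spline is an iterated average of a parallelepiped spline. -/
theorem exists_boxSplineAux_eq_averages {d : ℕ} : ∀ {n : ℕ} (Ξ : Matrix (Fin d) (Fin (d + n)) ℤ),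
    ∃ L : List (Fin d → ℤ),
      boxSplineAux d n (fun i j => (Ξ i j : ℝ)) =
        averages L (parallelepipedSpline fun j => intVec fun i => Ξ i (Fin.castAdd n j)) ∧
      ∀ w : (Fin d → ℤ) → ℕ, ∑ j, w (fun i => Ξ i j) =
        ∑ j, w (fun i => Ξ i (Fin.castAdd n j)) + (L.map w).sum
  | 0, Ξ => by
    refine ⟨[], ?_, fun w => by simp⟩
    ext x
    have hdet : (Matrix.of fun i j : Fin d => (Ξ i (Fin.cast (Nat.add_zero d).symm j) : ℝ)).det =
        (Matrix.of fun j => intVec fun i => Ξ i (Fin.castAdd 0 j)).det := by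
      rw [← Matrix.det_transpose]; rfl
    simp only [boxSplineAux, averages, List.foldr_nil, parallelepipedSpline, hdet]
    congr 1
    ext y
    refine exists_congr fun t => and_congr_right fun _ => ?_
    rw [show Matrix.mulVec _ t = ∑ j, t j • intVec (fun i => Ξ i (Fin.castAdd 0 j)) from ?_]
    ext i
    simp [Matrix.mulVec, dotProduct, intVec, mul_comm]
  | n + 1, Ξ => by
    obtain ⟨L, hL, hw⟩ := exists_boxSplineAux_eq_averages fun i (j : Fin (d + n)) => Ξ i j.castSucc
    refine ⟨(fun i => Ξ i (Fin.last (d + n))) :: L, ?_, fun w => ?_⟩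
    · ext x
      simp only [boxSplineAux, hL]
      rfl
    · have := Fin.sum_univ_castSucc (n := d + n) fun j => w (fun i => Ξ i j)
      refine this.trans ?_
      rw [hw w, List.map_cons, List.sum_cons]
      exact add_assoc _ _ _ |>.trans (congrArg _ (add_comm _ _))

section boxSplineR

variable {d m : ℕ}

theorem boxSplineR_le (Ξ : Matrix (Fin d) (Fin m) ℤ) {ℓ : (Fin d → ℝ) →ₗ[ℝ] ℝ} (hℓ : ℓ ≠ 0) :
    boxSplineR (Ξ.map (Int.cast : ℤ → ℝ)) ≤ ∑ j, offKernel ℓ fun i => Ξ i j := by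
  classical
  refine Nat.sInf_le ⟨Finset.univ.filter fun j => ℓ (intVec fun i => Ξ i j) ≠ 0, ?_, fun h => ?_⟩
  · rw [Finset.card_filter]
    exact Finset.sum_congr rfl fun j _ => by simp [offKernel]
  · refine hℓ (LinearMap.ker_eq_top.1 (top_le_iff.1 (h ▸ Submodule.span_le.2 ?_)))
    rintro _ ⟨j, hj, rfl⟩
    have hj' : ℓ (intVec fun i => Ξ i j) = 0 := by simpa using hj
    exact hj'

theorem boxSplineR_ne_zero (hd : 1 ≤ d) (hdm : d ≤ m) {Ξ : Matrix (Fin d) (Fin m) ℝ}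
    (hΞ : LinearIndependent ℝ fun j : Fin d => fun i => Ξ i (Fin.castLE hdm j)) :
    boxSplineR Ξ ≠ 0 := fun h => by
  rcases Nat.sInf_eq_zero.1 h with ⟨S, hS, hspan⟩ | h
  · rw [Finset.card_eq_zero.1 hS] at hspan
    refine hspan (top_le_iff.1 ?_)
    rw [← hΞ.span_eq_top_of_card_eq_finrank' (by simp)]
    refine Submodule.span_mono ?_
    rintro _ ⟨j, rfl⟩
    exact ⟨Fin.castLE hdm j, by simp, rfl⟩
  · have : Nonempty (Fin d) := ⟨⟨0, hd⟩⟩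
    exact (Set.eq_empty_iff_forall_notMem.1 h) _ ⟨Finset.univ, rfl, by simp [bot_ne_top]⟩

end boxSplineR

/-- the box spline space has approximation order `r(Ξ)` in the uniform
norm: every compactly supported smooth `f` can be approximated at scale `h` with
uniform error `O(h^{r(Ξ)})`. -/
theorem boxSpline_approximation_order {d m : ℕ} (hd : 1 ≤ d) (hdm : d ≤ m)
    (Ξ : Matrix (Fin d) (Fin m) ℤ)
    (hΞ : LinearIndependent ℝ fun j : Fin d => fun i =>
      (Ξ.map (Int.cast : ℤ → ℝ)) i (Fin.castLE hdm j))
    (f : (Fin d → ℝ) → ℝ) (hf : ContDiff ℝ (⊤ : ℕ∞) f) (hfc : HasCompactSupport f) :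
    ∃ C : ℝ, 0 < C ∧ ∀ h : ℝ, 0 < h → h < 1 →
      ∃ c : (Fin d → ℤ) → ℝ, ∀ x : Fin d → ℝ,
        |f x - ∑ᶠ j : Fin d → ℤ,
            c j * boxSpline hdm (Ξ.map (Int.cast : ℤ → ℝ)) (h⁻¹ • x - fun i => (j i : ℝ))| ≤
          C * h ^ boxSplineR (Ξ.map (Int.cast : ℤ → ℝ)) := by
  obtain ⟨k, hk⟩ := Nat.exists_eq_succ_of_ne_zero (boxSplineR_ne_zero hd hdm hΞ)
  obtain ⟨L, hL, hw⟩ := exists_boxSplineAux_eq_averages (n := m - d)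
    fun i j => Ξ i (Fin.cast (Nat.add_sub_cancel' hdm) j)
  have havg : IsAveraged k (boxSpline hdm (Ξ.map (Int.cast : ℤ → ℝ))) := by
    have e : boxSpline hdm (Ξ.map (Int.cast : ℤ → ℝ)) = _ := hL
    rw [e]
    refine isAveraged_averages hΞ fun ℓ hℓ => ?_
    rw [← hw, ← Nat.succ_eq_add_one, ← hk]
    refine (boxSplineR_le Ξ hℓ).trans_eq ?_
    exact (Equiv.sum_comp (finCongr (Nat.add_sub_cancel' hdm))
      fun j => offKernel ℓ fun i => Ξ i j).symm
  obtain ⟨C, hC, happrox⟩ := havg.approximation_order hf hfc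
  refine ⟨C, hC, fun h h₀ _ => ?_⟩
  rw [hk]
  exact happrox h h₀
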